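/- arXiv:2004.12325 — 3 statements merged into one kernel-verified Lean document; each statement's English description precedes it below -/
import Mathlib

section
/- Let X be a real Banach space and H a real Hilbert space. If T : X → H is a bounded linear operator whose adjoint T* : H* → X* is absolutely q-summing for some 1 ≤ q < ∞, then T is absolutely 1-summing. -/
open scoped BigOperators

/-- The weak `ℓ_p` norm of a finite family in a normed space:
`‖(xᵢ)‖_{p,w} = sup_{φ ∈ E*, ‖φ‖ ≤ 1} (∑ |φ(xᵢ)|^p)^{1/p}`. -/
noncomputable def weakNorm (p : ℝ) {E : Type*} [NormedAddCommGroup E] [NormedSpace ℝ E]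
    {n : ℕ} (x : Fin n → E) : ℝ :=
  ⨆ φ : {φ : E →L[ℝ] ℝ // ‖φ‖ ≤ 1}, (∑ i, |φ.1 (x i)| ^ p) ^ (1 / p)

/-- A map `u : E → F` is absolutely `p`-summing: there is `C ≥ 0` with
`(∑ ‖u(xᵢ)‖^p)^{1/p} ≤ C ‖(xᵢ)‖_{p,w}` for all finite families. -/
def AbsolutelySumming (p : ℝ) {E F : Type*} [NormedAddCommGroup E] [NormedSpace ℝ E]
    [NormedAddCommGroup F] (u : E → F) : Prop :=
  ∃ C : ℝ, 0 ≤ C ∧ ∀ (n : ℕ) (x : Fin n → E),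
    (∑ i, ‖u (x i)‖ ^ p) ^ (1 / p) ≤ C * weakNorm p x

/-- The signed sum `∑ ±aᵢ`, the sign of the `i`-th term being `+` exactly when `ε i` is `true`. -/
def signedSum {E : Type*} [AddCommGroup E] {n : ℕ} (a : Fin n → E) (ε : Fin n → Bool) : E :=
  ∑ i, if ε i then a i else -a i

theorem map_signedSum {E F G : Type*} [AddCommGroup E] [AddCommGroup F] [FunLike G E F]
    [AddMonoidHomClass G E F] {n : ℕ} (f : G) (a : Fin n → E) (ε : Fin n → Bool) :
    f (signedSum a ε) = signedSum (fun i => f (a i)) ε := by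
  simp only [signedSum, map_sum, apply_ite f, map_neg]

theorem sum_signedSum_succ {n : ℕ} (a : Fin (n + 1) → ℝ) (f : ℝ → ℝ) :
    ∑ ε, f (signedSum a ε) =
      ∑ ε, (f (signedSum (fun i => a i.succ) ε + a 0) +
        f (signedSum (fun i => a i.succ) ε - a 0)) := by
  rw [← (Fin.consEquiv fun _ => Bool).sum_comp, Fintype.sum_prod_type, Fintype.sum_bool,
    ← Finset.sum_add_distrib]
  refine Finset.sum_congr rfl fun ε _ => ?_
  simp [signedSum, Fin.sum_univ_succ, Fin.consEquiv, add_comm, sub_eq_add_neg]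

theorem sum_signedSum_sq {n : ℕ} (a : Fin n → ℝ) :
    ∑ ε, signedSum a ε ^ 2 = 2 ^ n * ∑ i, a i ^ 2 := by
  induction n with
  | zero => simp [signedSum]
  | succ n ih =>
    have h (s : ℝ) : (s + a 0) ^ 2 + (s - a 0) ^ 2 = 2 * s ^ 2 + 2 * a 0 ^ 2 := by ring
    rw [sum_signedSum_succ a (· ^ 2), Fin.sum_univ_succ]
    simp only [h, Finset.sum_add_distrib, ← Finset.mul_sum, ih]
    simp
    ring

theorem sum_signedSum_pow_four_le {n : ℕ} (a : Fin n → ℝ) :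
    ∑ ε, signedSum a ε ^ 4 ≤ 2 ^ n * (3 * (∑ i, a i ^ 2) ^ 2) := by
  induction n with
  | zero => simp [signedSum]
  | succ n ih =>
    have h (s : ℝ) : (s + a 0) ^ 4 + (s - a 0) ^ 4 =
        2 * s ^ 4 + (12 * a 0 ^ 2) * s ^ 2 + 2 * a 0 ^ 4 := by ring
    rw [sum_signedSum_succ a (· ^ 4), Fin.sum_univ_succ]
    simp only [h, Finset.sum_add_distrib, ← Finset.mul_sum, sum_signedSum_sq]
    have ih := ih fun i => a i.succ
    have h4 : (0 : ℝ) ≤ 2 ^ n * a 0 ^ 4 := by positivity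
    simp only [Finset.sum_const, Finset.card_univ, Fintype.card_fun, Fintype.card_bool,
      Fintype.card_fin, nsmul_eq_mul, Nat.cast_pow, Nat.cast_ofNat]
    rw [pow_succ (2 : ℝ) n]
    nlinarith

theorem sum_cosh_signedSum_le {n : ℕ} (a : Fin n → ℝ) :
    ∑ ε, Real.cosh (signedSum a ε) ≤ 2 ^ n * Real.exp ((∑ i, a i ^ 2) / 2) := by
  induction n with
  | zero => simp [signedSum]
  | succ n ih =>
    have h (s : ℝ) : Real.cosh (s + a 0) + Real.cosh (s - a 0) =
        2 * Real.cosh (a 0) * Real.cosh s := by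
      rw [Real.cosh_add, Real.cosh_sub]; ring
    rw [sum_signedSum_succ a Real.cosh, Fin.sum_univ_succ]
    simp only [h, ← Finset.mul_sum]
    calc 2 * Real.cosh (a 0) * ∑ ε, Real.cosh (signedSum (fun i => a i.succ) ε)
        ≤ 2 * Real.exp (a 0 ^ 2 / 2) * (2 ^ n * Real.exp ((∑ i : Fin n, a i.succ ^ 2) / 2)) := by
          gcongr
          · exact Real.cosh_le_exp_half_sq _
          · exact ih _
      _ = _ := by rw [add_div, Real.exp_add]; ring

/-- The lower Khintchine inequality in `L¹`. -/
theorem khintchine_lower {n : ℕ} (a : Fin n → ℝ) :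
    2 ^ n * √(∑ i, a i ^ 2) ≤ 2 * ∑ ε, |signedSum a ε| := by
  set r := √(∑ i, a i ^ 2)
  have hr0 : 0 ≤ r := Real.sqrt_nonneg _
  have hrs : ∑ i, a i ^ 2 = r ^ 2 := (Real.sq_sqrt (by positivity)).symm
  rcases hr0.eq_or_lt with h0 | hpos
  · rw [← h0]
    simpa using Finset.sum_nonneg fun ε _ => abs_nonneg (signedSum a ε)
  have key (s : ℝ) : 6 * r ^ 2 * s ^ 2 - s ^ 4 ≤ 6 * r ^ 3 * |s| := by
    rw [← sq_abs s, ← Even.pow_abs (by decide : Even 4) s]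
    have ht := abs_nonneg s
    generalize |s| = t at ht ⊢
    have h1 : 0 ≤ 6 * r ^ 3 - 6 * r ^ 2 * t + t ^ 3 := by
      nlinarith [mul_nonneg ht (sq_nonneg (5 * t - 7 * r)),
        mul_nonneg hr0 (sq_nonneg (5 * t - 7 * r)), pow_pos hpos 3]
    nlinarith [mul_nonneg ht h1]
  have h := Finset.sum_le_sum fun (ε : Fin n → Bool) (_ : ε ∈ Finset.univ) => key (signedSum a ε)
  rw [Finset.sum_sub_distrib, ← Finset.mul_sum, ← Finset.mul_sum, sum_signedSum_sq, hrs] at h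
  have h4 := sum_signedSum_pow_four_le a
  rw [hrs] at h4
  have : 3 * r ^ 3 * (2 ^ n * r) ≤ 3 * r ^ 3 * (2 * ∑ ε, |signedSum a ε|) := by
    nlinarith
  exact le_of_mul_le_mul_left this (by positivity)

theorem exists_abs_rpow_le_cosh {q : ℝ} (hq : 0 ≤ q) :
    ∃ K : ℝ, 0 ≤ K ∧ ∀ s : ℝ, |s| ^ q ≤ K * Real.cosh s := by
  refine ⟨2 * (1 + (⌈q⌉₊).factorial), by positivity, fun s => ?_⟩
  have hexp : Real.exp |s| ≤ 2 * Real.cosh s := by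
    rw [← Real.cosh_abs, Real.cosh_eq]
    linarith [Real.exp_pos (-|s|)]
  have hpow : |s| ^ ⌈q⌉₊ ≤ (⌈q⌉₊).factorial * Real.exp |s| := by
    have := Real.pow_div_factorial_le_exp |s| (abs_nonneg s) ⌈q⌉₊
    rwa [div_le_iff₀' (by positivity)] at this
  have hone : |s| ^ q ≤ 1 + |s| ^ ⌈q⌉₊ := by
    rcases le_total |s| 1 with h | h
    · have := Real.rpow_le_one (abs_nonneg s) h hq
      linarith [pow_nonneg (abs_nonneg s) ⌈q⌉₊]
    · have := Real.rpow_le_rpow_of_exponent_le h (Nat.le_ceil q)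
      rw [Real.rpow_natCast] at this
      linarith
  calc |s| ^ q ≤ (1 + (⌈q⌉₊).factorial) * Real.exp |s| := by
        linarith [Real.one_le_exp (abs_nonneg s)]
    _ ≤ (1 + (⌈q⌉₊).factorial) * (2 * Real.cosh s) := by gcongr
    _ = _ := by ring

/-- The upper Khintchine inequality in `L^q`. -/
theorem exists_khintchine_upper {q : ℝ} (hq : 0 ≤ q) :
    ∃ K : ℝ, 0 ≤ K ∧ ∀ (n : ℕ) (a : Fin n → ℝ), ∑ i, a i ^ 2 ≤ 1 →
      ∑ ε, |signedSum a ε| ^ q ≤ 2 ^ n * K := by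
  obtain ⟨K, hK, h⟩ := exists_abs_rpow_le_cosh hq
  refine ⟨K * Real.exp (1 / 2), by positivity, fun n a ha => ?_⟩
  calc ∑ ε, |signedSum a ε| ^ q ≤ ∑ ε, K * Real.cosh (signedSum a ε) :=
        Finset.sum_le_sum fun ε _ => h _
    _ = K * ∑ ε, Real.cosh (signedSum a ε) := by rw [Finset.mul_sum]
    _ ≤ K * (2 ^ n * Real.exp (1 / 2)) := by
        refine mul_le_mul_of_nonneg_left ((sum_cosh_signedSum_le a).trans ?_) hK
        gcongr
    _ = _ := by ring

section WeakNorm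

variable {E : Type*} [NormedAddCommGroup E] [NormedSpace ℝ E] {n : ℕ}

theorem weakNorm_nonneg (p : ℝ) (x : Fin n → E) : 0 ≤ weakNorm p x :=
  Real.iSup_nonneg fun _ => by positivity

theorem weakNorm_le {p c : ℝ} {x : Fin n → E}
    (h : ∀ φ : E →L[ℝ] ℝ, ‖φ‖ ≤ 1 → (∑ i, |φ (x i)| ^ p) ^ (1 / p) ≤ c) :
    weakNorm p x ≤ c :=
  have : Nonempty {φ : E →L[ℝ] ℝ // ‖φ‖ ≤ 1} := ⟨⟨0, by simp⟩⟩
  ciSup_le fun φ => h φ.1 φ.2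

theorem le_weakNorm {p : ℝ} (hp : 0 ≤ p) (x : Fin n → E) {φ : E →L[ℝ] ℝ} (hφ : ‖φ‖ ≤ 1) :
    (∑ i, |φ (x i)| ^ p) ^ (1 / p) ≤ weakNorm p x := by
  refine le_ciSup (f := fun φ : {φ : E →L[ℝ] ℝ // ‖φ‖ ≤ 1} =>
    (∑ i, |φ.1 (x i)| ^ p) ^ (1 / p)) ⟨(∑ i, ‖x i‖ ^ p) ^ (1 / p), ?_⟩ ⟨φ, hφ⟩
  rintro _ ⟨ψ, rfl⟩
  dsimp only
  gcongr with i
  simpa using ψ.1.le_of_opNorm_le ψ.2 (x i)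

theorem sum_abs_le_norm_mul_weakNorm_one (x : Fin n → E) (φ : E →L[ℝ] ℝ) :
    ∑ i, |φ (x i)| ≤ ‖φ‖ * weakNorm 1 x := by
  rcases eq_or_ne φ 0 with rfl | hφ
  · simp
  have hpos : 0 < ‖φ‖ := norm_pos_iff.2 hφ
  have h := le_weakNorm zero_le_one x (φ := ‖φ‖⁻¹ • φ)
    (by rw [norm_smul, norm_inv, norm_norm, inv_mul_cancel₀ hpos.ne'])
  simp only [smul_apply, smul_eq_mul, abs_mul, abs_inv, abs_norm, Real.rpow_one, div_one,
    ← Finset.mul_sum] at h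
  rwa [inv_mul_le_iff₀ hpos] at h

end WeakNorm

theorem sum_sq_apply_innerSL_le_one {H : Type*} [NormedAddCommGroup H] [InnerProductSpace ℝ H]
    {n : ℕ} {e : Fin n → H} (he : Orthonormal ℝ e) {φ : (H →L[ℝ] ℝ) →L[ℝ] ℝ} (hφ : ‖φ‖ ≤ 1) :
    ∑ k, φ (innerSL ℝ (e k)) ^ 2 ≤ 1 := by
  set c : Fin n → ℝ := fun k => φ (innerSL ℝ (e k)) with hc
  have hnorm : ‖∑ k, c k • e k‖ ^ 2 = ∑ k, c k ^ 2 := by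
    rw [← real_inner_self_eq_norm_sq, he.inner_sum]
    simp [sq]
  have hle : ∑ k, c k ^ 2 ≤ ‖∑ k, c k • e k‖ := by
    have h1 : ∑ k, c k ^ 2 = φ (innerSL ℝ (∑ k, c k • e k)) := by
      simp [map_sum, hc, sq]
    rw [h1]
    refine (le_abs_self _).trans ((φ.le_of_opNorm_le hφ _).trans ?_)
    rw [one_mul, innerSL_apply_norm]
  rw [← hnorm] at hle ⊢
  nlinarith [norm_nonneg (∑ k, c k • e k)]

theorem AbsolutelySumming.exists_sum_rpow_le {q : ℝ} (hq : 0 < q) {E F : Type*}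
    [NormedAddCommGroup E] [NormedSpace ℝ E] [NormedAddCommGroup F] {u : E → F}
    (hu : AbsolutelySumming q u) :
    ∃ C : ℝ, 0 ≤ C ∧ ∀ {ι : Type} [Fintype ι] (x : ι → E) (K : ℝ), 0 ≤ K →
      (∀ φ : E →L[ℝ] ℝ, ‖φ‖ ≤ 1 → ∑ i, |φ (x i)| ^ q ≤ K) → ∑ i, ‖u (x i)‖ ^ q ≤ C * K := by
  obtain ⟨C, hC, h⟩ := hu
  refine ⟨C ^ q, by positivity, fun {ι} _ x K hK hx => ?_⟩
  let e := Fintype.equivFin ι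
  have hw : weakNorm q (fun i => x (e.symm i)) ≤ K ^ (1 / q) := by
    refine weakNorm_le fun φ hφ => ?_
    rw [e.symm.sum_comp fun i => |φ (x i)| ^ q]
    gcongr
    exact hx φ hφ
  have h1 := (h _ fun i => x (e.symm i)).trans (mul_le_mul_of_nonneg_left hw hC)
  rw [e.symm.sum_comp fun i => ‖u (x i)‖ ^ q] at h1
  have h2 := Real.rpow_le_rpow (by positivity) h1 hq.le
  rwa [Real.mul_rpow hC (by positivity), one_div, Real.rpow_inv_rpow (by positivity) hq.ne',
    Real.rpow_inv_rpow hK hq.ne'] at h2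

theorem exists_sum_norm_signedSum_comp_le {X H : Type*} [NormedAddCommGroup X] [NormedSpace ℝ X]
    [NormedAddCommGroup H] [InnerProductSpace ℝ H] (T : X →L[ℝ] H) {q : ℝ} (hq : 1 ≤ q)
    (hT : AbsolutelySumming q (fun ψ : H →L[ℝ] ℝ => ψ.comp T)) :
    ∃ C : ℝ, 0 ≤ C ∧ ∀ (n : ℕ) (e : Fin n → H), Orthonormal ℝ e →
      ∑ ε, ‖(innerSL ℝ (signedSum e ε)).comp T‖ ≤ 2 ^ n * C := by
  have hq0 : 0 < q := one_pos.trans_le hq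
  obtain ⟨C, hC, h⟩ := hT.exists_sum_rpow_le hq0
  obtain ⟨K, hK, hKh⟩ := exists_khintchine_upper hq0.le
  refine ⟨1 + C * K, by positivity, fun n e he => ?_⟩
  have h1 := h (fun ε => innerSL ℝ (signedSum e ε)) (2 ^ n * K) (by positivity) fun φ hφ => by
    simp only [map_signedSum]
    exact hKh n _ (sum_sq_apply_innerSL_le_one he hφ)
  have h2 (t : ℝ) (ht : 0 ≤ t) : t ≤ 1 + t ^ q := by
    rcases le_total t 1 with ht1 | ht1
    · linarith [Real.rpow_nonneg ht q]
    · linarith [Real.self_le_rpow_of_one_le ht1 hq]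
  calc ∑ ε, ‖(innerSL ℝ (signedSum e ε)).comp T‖
      ≤ ∑ ε, (1 + ‖(innerSL ℝ (signedSum e ε)).comp T‖ ^ q) :=
        Finset.sum_le_sum fun ε _ => h2 _ (norm_nonneg _)
    _ = 2 ^ n + ∑ ε, ‖(innerSL ℝ (signedSum e ε)).comp T‖ ^ q := by
        simp [Finset.sum_add_distrib]
    _ ≤ 2 ^ n + C * (2 ^ n * K) := by gcongr
    _ = _ := by ring

/-- **Kwapień's theorem.** If `X` is a real Banach space, `H` a real Hilbert space and
`T : X → H` a bounded linear operator whose adjoint `T* : H* → X*`, `ψ ↦ ψ ∘ T`, is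
absolutely `q`-summing for some `1 ≤ q < ∞`, then `T` is absolutely `1`-summing. -/
theorem kwapien {X H : Type*} [NormedAddCommGroup X] [NormedSpace ℝ X] [CompleteSpace X]
    [NormedAddCommGroup H] [InnerProductSpace ℝ H] [CompleteSpace H]
    (T : X →L[ℝ] H)
    (hadj : ∃ q : ℝ, 1 ≤ q ∧
      AbsolutelySumming q (fun ψ : H →L[ℝ] ℝ => ψ.comp T)) :
    AbsolutelySumming 1 (fun x => T x) := by
  obtain ⟨q, hq, hT⟩ := hadj
  obtain ⟨C, hC, h⟩ := exists_sum_norm_signedSum_comp_le T hq hT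
  refine ⟨2 * C, by positivity, fun n x => ?_⟩
  simp only [Real.rpow_one, div_one]
  let V : Submodule ℝ H := Submodule.span ℝ (Set.range fun i => T (x i))
  have : FiniteDimensional ℝ V := FiniteDimensional.span_of_finite ℝ (Set.finite_range _)
  let b := stdOrthonormalBasis ℝ V
  let e : Fin (Module.finrank ℝ V) → H := fun k => b k
  have he : Orthonormal ℝ e := b.orthonormal.comp_linearIsometry V.subtypeₗᵢ
  have hnorm (i : Fin n) : ‖T (x i)‖ = √(∑ k, (inner ℝ (e k) (T (x i))) ^ 2) := by
    let v : V := ⟨T (x i), Submodule.subset_span ⟨i, rfl⟩⟩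
    have := b.sum_sq_norm_inner_right v
    simp only [Real.norm_eq_abs, sq_abs] at this
    rw [show ‖T (x i)‖ = ‖v‖ from rfl, ← Real.sqrt_sq (norm_nonneg v), ← this]
    rfl
  have happ (ε) (i : Fin n) : signedSum (fun k => inner ℝ (e k) (T (x i))) ε =
      (innerSL ℝ (signedSum e ε)).comp T (x i) :=
    (map_signedSum ((innerSL ℝ).flip (T (x i))) e ε).symm
  have hpow : (0 : ℝ) < 2 ^ Module.finrank ℝ V := by positivity
  refine le_of_mul_le_mul_left ?_ hpow
  calc 2 ^ Module.finrank ℝ V * ∑ i, ‖T (x i)‖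
      ≤ ∑ i, 2 * ∑ ε, |(innerSL ℝ (signedSum e ε)).comp T (x i)| := by
        rw [Finset.mul_sum]
        refine Finset.sum_le_sum fun i _ => ?_
        simp only [hnorm, ← happ]
        exact khintchine_lower _
    _ = 2 * ∑ ε, ∑ i, |(innerSL ℝ (signedSum e ε)).comp T (x i)| := by
        rw [← Finset.mul_sum, Finset.sum_comm]
    _ ≤ 2 * ∑ ε, ‖(innerSL ℝ (signedSum e ε)).comp T‖ * weakNorm 1 x := by
        gcongr
        exact sum_abs_le_norm_mul_weakNorm_one x _
    _ ≤ 2 * ((2 ^ Module.finrank ℝ V * C) * weakNorm 1 x) := by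
        rw [← Finset.sum_mul]
        have := weakNorm_nonneg 1 x
        gcongr
        exact h _ e he
    _ = _ := by ring
end

section
/- Let X be a real Banach space, let 2 ≤ p < ∞, and let Y be a real Banach space that is an L_p-space. If T : X → Y is a bounded linear operator whose adjoint T* : Y* → X* is almost p-summing, then T is absolutely 1-summing. -/
open scoped BigOperators

/-- The Rademacher average `(2^{-n} ∑_{ε ∈ {−1,1}^n} ‖∑ εᵢ yᵢ‖²)^{1/2}`. -/
noncomputable def radAvg {F : Type*} [NormedAddCommGroup F] [NormedSpace ℝ F]
    {n : ℕ} (y : Fin n → F) : ℝ :=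
  Real.sqrt ((2 ^ n : ℝ)⁻¹ *
    ∑ ε : Fin n → Bool, ‖∑ i, (if ε i then (1 : ℝ) else -1) • y i‖ ^ 2)

/-- A map `u : E → F` is almost `p`-summing: there is `C ≥ 0` such that
`(2^{-n} ∑_ε ‖∑ εᵢ u(xᵢ)‖²)^{1/2} ≤ C ‖(xᵢ)‖_{p,w}` for all finite families. -/
def AlmostSumming (p : ℝ) {E F : Type*} [NormedAddCommGroup E] [NormedSpace ℝ E]
    [NormedAddCommGroup F] [NormedSpace ℝ F] (u : E → F) : Prop :=
  ∃ C : ℝ, 0 ≤ C ∧ ∀ (n : ℕ) (x : Fin n → E),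
    radAvg (fun i => u (x i)) ≤ C * weakNorm p x

/-- A map `u : E → F` is absolutely `1`-summing. -/
def AbsolutelyOneSumming {E F : Type*} [NormedAddCommGroup E] [NormedSpace ℝ E]
    [NormedAddCommGroup F] (u : E → F) : Prop :=
  ∃ C : ℝ, 0 ≤ C ∧ ∀ (n : ℕ) (x : Fin n → E),
    ∑ i, ‖u (x i)‖ ≤ C * weakNorm 1 x

/-- The `ℓ_p` norm on `ℝ^m`. -/
noncomputable def lpNorm (p : ℝ) {m : ℕ} (y : Fin m → ℝ) : ℝ :=
  (∑ k, |y k| ^ p) ^ (1 / p)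

/-- `Y` is an `L_{p,λ}`-space: every finite-dimensional subspace `E` of `Y` is contained in a
finite-dimensional subspace `Y₀` admitting a linear isomorphism `v : Y₀ → ℓ_p^{dim Y₀}` with
`‖v‖ ⬝ ‖v⁻¹‖ ≤ λ`. -/
def IsLpSpaceWith (p lam : ℝ) (Y : Type*) [NormedAddCommGroup Y] [NormedSpace ℝ Y] : Prop :=
  ∀ E : Submodule ℝ Y, FiniteDimensional ℝ E →
    ∃ Y₀ : Submodule ℝ Y, E ≤ Y₀ ∧ FiniteDimensional ℝ Y₀ ∧
      ∃ v : Y₀ ≃ₗ[ℝ] (Fin (Module.finrank ℝ Y₀) → ℝ), ∃ a b : ℝ,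
        (∀ y : Y₀, lpNorm p (v y) ≤ a * ‖y‖) ∧
        (∀ z : Fin (Module.finrank ℝ Y₀) → ℝ, ‖v.symm z‖ ≤ b * lpNorm p z) ∧
        a * b ≤ lam

theorem sum_bool_cons {n : ℕ} (f : (Fin (n+1) → Bool) → ℝ) :
    ∑ ε, f ε = ∑ ε : Fin n → Bool, (f (Fin.cons true ε) + f (Fin.cons false ε)) := by
  rw [← (Fin.consEquiv (fun _ : Fin (n+1) => Bool)).sum_comp, Fintype.sum_prod_type]
  simp [Fin.consEquiv, Finset.sum_add_distrib]

/-- The sum `∑ εₖ cₖ` for a choice of signs `ε`. -/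
def radSum {n : ℕ} (c : Fin n → ℝ) (ε : Fin n → Bool) : ℝ :=
  ∑ k, (if ε k then (1:ℝ) else -1) * c k

theorem sum_radSum_sq {n : ℕ} (c : Fin n → ℝ) (t : ℝ) :
    ∑ ε, (t + radSum c ε) ^ 2 = 2 ^ n * (t ^ 2 + ∑ k, c k ^ 2) := by
  induction n generalizing t with
  | zero => simp [radSum]
  | succ n ih =>
    rw [sum_bool_cons, Finset.sum_add_distrib, Fin.sum_univ_succ]
    have h := ih (fun k => c k.succ)
    simp only [radSum] at h ⊢
    simp only [Fin.sum_univ_succ, Fin.cons_zero, Fin.cons_succ, ← add_assoc, h]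
    simp; ring

theorem sum_radSum_pow_four_le {n : ℕ} (c : Fin n → ℝ) (t : ℝ) :
    ∑ ε, (t + radSum c ε) ^ 4 ≤
      2 ^ n * (t ^ 4 + 6 * t ^ 2 * (∑ k, c k ^ 2) + 3 * (∑ k, c k ^ 2) ^ 2) := by
  induction n generalizing t with
  | zero => simp [radSum]
  | succ n ih =>
    rw [sum_bool_cons, Finset.sum_add_distrib, Fin.sum_univ_succ]
    have h := ih (fun k => c k.succ)
    simp only [radSum] at h ⊢
    simp only [Fin.sum_univ_succ, Fin.cons_zero, Fin.cons_succ, ← add_assoc]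
    refine (add_le_add (h _) (h _)).trans ?_
    have : 0 ≤ (2:ℝ)^n * (c 0)^4 := by positivity
    simp only [if_true, Bool.false_eq_true, if_false]
    ring_nf at this ⊢
    linarith

/-- Khintchine's inequality between the first and the second moment. -/
theorem khintchine {n : ℕ} (c : Fin n → ℝ) :
    2 ^ n * (5 / 9 * √(∑ k, c k ^ 2)) ≤ ∑ ε, |radSum c ε| := by
  set s := √(∑ k, c k ^ 2) with hs
  have hs2 : s ^ 2 = ∑ k, c k ^ 2 := Real.sq_sqrt (by positivity)
  have hs0 : 0 ≤ s := Real.sqrt_nonneg _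
  rcases hs0.eq_or_lt with h0 | h0
  · rw [← h0]; simp; positivity
  have h2 := sum_radSum_sq c 0
  have h4 := sum_radSum_pow_four_le c 0
  simp only [zero_add, ← hs2] at h2 h4
  have key : ∀ t : ℝ, s ^ 2 * t ^ 2 - 4 / 27 * t ^ 4 ≤ s ^ 3 * |t| := by
    intro t
    rw [← sq_abs t, show t ^ 4 = |t| ^ 4 by rw [← abs_pow, abs_of_nonneg (by positivity)]]
    have := abs_nonneg t
    have h : 0 ≤ |t| * (|t| - 3 / 2 * s) ^ 2 * (|t| + 3 * s) := by positivity
    nlinarith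
  have hsum := Finset.sum_le_sum fun ε (_ : ε ∈ Finset.univ) => key (radSum c ε)
  rw [Finset.sum_sub_distrib, ← Finset.mul_sum, ← Finset.mul_sum, ← Finset.mul_sum, h2] at hsum
  have : s ^ 3 * (2 ^ n * (5 / 9 * s)) ≤ s ^ 3 * ∑ ε, |radSum c ε| := by
    refine le_trans ?_ hsum
    ring_nf at h4 ⊢
    linarith
  exact le_of_mul_le_mul_left this (by positivity)

theorem lpNorm_nonneg (p : ℝ) {m : ℕ} (y : Fin m → ℝ) : 0 ≤ lpNorm p y := by
  unfold lpNorm; positivity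

theorem lpNorm_rpow {p : ℝ} (hp : 0 < p) {m : ℕ} (y : Fin m → ℝ) :
    lpNorm p y ^ p = ∑ k, |y k| ^ p := by
  rw [lpNorm, ← Real.rpow_mul (by positivity), one_div_mul_cancel hp.ne', Real.rpow_one]

theorem abs_le_lpNorm {p : ℝ} (hp : 0 < p) {m : ℕ} (y : Fin m → ℝ) (k : Fin m) :
    |y k| ≤ lpNorm p y := by
  rw [← Real.rpow_le_rpow_iff (abs_nonneg _) (lpNorm_nonneg p y) hp, lpNorm_rpow hp]
  exact Finset.single_le_sum (f := fun k => |y k| ^ p) (fun _ _ => by positivity)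
    (Finset.mem_univ k)

theorem lpNorm_smul {p : ℝ} (hp : 0 < p) {m : ℕ} {c : ℝ} (hc : 0 ≤ c) (y : Fin m → ℝ) :
    lpNorm p (c • y) = c * lpNorm p y := by
  simp only [lpNorm, Pi.smul_apply, smul_eq_mul, abs_mul, abs_of_nonneg hc]
  simp_rw [Real.mul_rpow hc (abs_nonneg _)]
  rw [← Finset.mul_sum, Real.mul_rpow (by positivity) (by positivity), ← Real.rpow_mul hc,
    mul_one_div_cancel hp.ne', Real.rpow_one]

theorem lpNorm_le_sqrt {p : ℝ} (hp : 2 ≤ p) {m : ℕ} (y : Fin m → ℝ) :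
    lpNorm p y ≤ √(∑ k, y k ^ 2) := by
  set s := √(∑ k, y k ^ 2) with hs
  have hs2 : s ^ 2 = ∑ k, y k ^ 2 := Real.sq_sqrt (by positivity)
  have hs0 : 0 ≤ s := Real.sqrt_nonneg _
  have hp0 : 0 < p := by linarith
  rw [← Real.rpow_le_rpow_iff (lpNorm_nonneg p y) hs0 hp0, lpNorm_rpow hp0]
  have split : ∀ t : ℝ, 0 ≤ t → t ^ p = t ^ 2 * t ^ (p - 2) := by
    intro t ht
    rw [← Real.rpow_natCast, ← Real.rpow_add_of_nonneg ht (by norm_num) (by linarith)]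
    congr 1; push_cast; ring
  rw [split s hs0, hs2, Finset.sum_mul]
  refine Finset.sum_le_sum fun k _ => ?_
  rw [split _ (abs_nonneg _), sq_abs]
  refine mul_le_mul_of_nonneg_left (Real.rpow_le_rpow (abs_nonneg _) ?_ (by linarith))
    (sq_nonneg _)
  exact Real.abs_le_sqrt (Finset.single_le_sum (f := fun k => y k ^ 2)
    (fun _ _ => by positivity) (Finset.mem_univ k))

theorem continuous_lpNorm {p : ℝ} (hp : 0 < p) {m : ℕ} :
    Continuous (lpNorm p : (Fin m → ℝ) → ℝ) := by
  unfold lpNorm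
  refine Continuous.rpow_const (continuous_finsetSum _ fun k _ =>
    Continuous.rpow_const (by fun_prop) fun _ => Or.inr hp.le) fun _ => Or.inr (by positivity)

/-- A weighted average over each block of a partition of the coordinates is a contraction of
`ℓ_p`. -/
noncomputable def blockMean (q : ℝ) {m M : ℕ} (g : Fin m → Fin M) (ω : Fin m → ℝ) :
    (Fin m → ℝ) →ₗ[ℝ] (Fin M → ℝ) where
  toFun z j := (∑ k with g k = j, ω k ^ (1 / q) * z k) / (∑ k with g k = j, ω k) ^ (1 / q)
  map_add' z z' := by
    ext j; simp only [Pi.add_apply, mul_add, Finset.sum_add_distrib, add_div]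
  map_smul' c z := by
    ext j
    simp only [Pi.smul_apply, smul_eq_mul, RingHom.id_apply, mul_left_comm _ c, ← Finset.mul_sum,
      mul_div_assoc]

theorem lpNorm_blockMean_le {p q : ℝ} (hpq : p.HolderConjugate q) {m M : ℕ} (g : Fin m → Fin M)
    {ω : Fin m → ℝ} (hω : ∀ k, 0 ≤ ω k) (z : Fin m → ℝ) :
    lpNorm p (blockMean q g ω z) ≤ lpNorm p z := by
  have hp := hpq.pos
  have hq := hpq.symm.pos
  rw [← Real.rpow_le_rpow_iff (lpNorm_nonneg p _) (lpNorm_nonneg p z) hp, lpNorm_rpow hp,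
    lpNorm_rpow hp, ← Finset.sum_fiberwise Finset.univ g]
  refine Finset.sum_le_sum fun j _ => ?_
  set Z := ∑ k with g k = j, |z k| ^ p
  have hZ : 0 ≤ Z := Finset.sum_nonneg fun _ _ => by positivity
  set Ω := ∑ k with g k = j, ω k with hΩdef
  have hΩ : 0 ≤ Ω := Finset.sum_nonneg fun k _ => hω k
  have hnum : |∑ k with g k = j, ω k ^ (1 / q) * z k| ≤ Ω ^ (1 / q) * Z ^ (1 / p) := by
    have h := Real.inner_le_Lp_mul_Lq (Finset.univ.filter fun k => g k = j)
      (fun k => ω k ^ (1 / q)) (fun k => |z k|) hpq.symm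
    have e : ∀ k, |ω k ^ (1 / q)| ^ q = ω k := fun k => by
      rw [abs_of_nonneg (Real.rpow_nonneg (hω k) _), ← Real.rpow_mul (hω k),
        one_div_mul_cancel hq.ne', Real.rpow_one]
    simp only [e, abs_abs] at h
    refine (Finset.abs_sum_le_sum_abs _ _).trans (le_trans (le_of_eq ?_) h)
    refine Finset.sum_congr rfl fun k _ => ?_
    rw [abs_mul, abs_of_nonneg (Real.rpow_nonneg (hω k) _)]
  have habs : |blockMean q g ω z j| ≤ Z ^ (1 / p) := by
    change |_ / Ω ^ (1 / q)| ≤ _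
    rw [abs_div, abs_of_nonneg (Real.rpow_nonneg hΩ _)]
    exact div_le_of_le_mul₀ (by positivity) (by positivity) (hnum.trans (mul_comm _ _).le)
  calc |blockMean q g ω z j| ^ p ≤ (Z ^ (1 / p)) ^ p := by gcongr
    _ = Z := by rw [← Real.rpow_mul hZ, one_div_mul_cancel hp.ne', Real.rpow_one]

/-- If `r k = ω k ^ (1 / p) * u k` with `u` nearly constant on the blocks, then averaging
over the blocks almost preserves the `ℓ_p` norm of `r`. -/
theorem lpNorm_le_lpNorm_blockMean_add {p q : ℝ} (hpq : p.HolderConjugate q) {m M : ℕ}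
    (g : Fin m → Fin M) {ω : Fin m → ℝ} (hω : ∀ k, 0 ≤ ω k) (u : Fin m → ℝ) {δ : ℝ} (hδ : 0 ≤ δ)
    (hu : ∀ k l, g k = g l → |u k - u l| ≤ δ) :
    lpNorm p (fun k => ω k ^ (1 / p) * u k) ≤
      lpNorm p (blockMean q g ω fun k => ω k ^ (1 / p) * u k) + δ * (∑ k, ω k) ^ (1 / p) := by
  have hp := hpq.pos
  have hq := hpq.symm.pos
  have hsum : 1 / p + 1 / q = 1 := by simpa using hpq.inv_add_inv_eq_one
  set Ω : Fin M → ℝ := fun j => ∑ k with g k = j, ω k with hΩdef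
  have hΩ : ∀ j, 0 ≤ Ω j := fun j => Finset.sum_nonneg fun k _ => hω k
  set a : Fin M → ℝ := fun j => (∑ k with g k = j, ω k * u k) / Ω j with ha
  have split : ∀ x : ℝ, 0 ≤ x → x ^ (1 / q) * x ^ (1 / p) = x := fun x hx => by
    rw [← Real.rpow_add_of_nonneg hx (by positivity) (by positivity), add_comm, hsum,
      Real.rpow_one]
  have rp : ∀ x : ℝ, 0 ≤ x → (x ^ (1 / p)) ^ p = x := fun x hx => by
    rw [← Real.rpow_mul hx, one_div_mul_cancel hp.ne', Real.rpow_one]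
  have hmean : ∀ j, blockMean q g ω (fun k => ω k ^ (1 / p) * u k) j = Ω j ^ (1 / p) * a j := by
    intro j
    change (∑ k with g k = j, ω k ^ (1 / q) * (ω k ^ (1 / p) * u k)) / Ω j ^ (1 / q) = _
    simp only [← mul_assoc, split _ (hω _)]
    rcases (hΩ j).eq_or_lt with h | h
    · rw [← h, Real.zero_rpow (by positivity), Real.zero_rpow (by positivity)]; simp
    · have h1 : 0 < Ω j ^ (1 / q) := Real.rpow_pos_of_pos h _
      simp only [ha]
      rw [div_eq_iff h1.ne', mul_right_comm, mul_comm (Ω j ^ (1 / p)), split _ h.le,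
        mul_div_cancel₀ _ h.ne']
  have hclose : ∀ k, ω k ^ (1 / p) * |u k - a (g k)| ≤ ω k ^ (1 / p) * δ := by
    intro k
    rcases (hω k).eq_or_lt with h | h
    · rw [← h, Real.zero_rpow (by positivity)]; simp
    refine mul_le_mul_of_nonneg_left ?_ (by positivity)
    have hpos : 0 < Ω (g k) := lt_of_lt_of_le h
      (Finset.single_le_sum (f := ω) (fun k _ => hω k) (by simp))
    have : u k - a (g k) = (∑ l with g l = g k, ω l * (u k - u l)) / Ω (g k) := by
      simp only [ha, mul_sub, Finset.sum_sub_distrib, ← Finset.sum_mul, sub_div]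
      rw [mul_div_cancel_left₀ _ hpos.ne']
    rw [this, abs_div, abs_of_pos hpos, div_le_iff₀ hpos]
    refine (Finset.abs_sum_le_sum_abs _ _).trans ?_
    rw [Finset.mul_sum]
    refine Finset.sum_le_sum fun l hl => ?_
    rw [abs_mul, abs_of_nonneg (hω l), mul_comm]
    refine mul_le_mul_of_nonneg_right (hu k l ?_) (hω l)
    simpa using (Finset.mem_filter.1 hl).2.symm
  have hmink := Real.Lp_add_le Finset.univ (fun k => ω k ^ (1 / p) * a (g k))
    (fun k => ω k ^ (1 / p) * (u k - a (g k))) hpq.lt.le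
  have e1 : ∑ k, |ω k ^ (1 / p) * a (g k)| ^ p =
      ∑ j, |blockMean q g ω (fun k => ω k ^ (1 / p) * u k) j| ^ p := by
    rw [← Finset.sum_fiberwise Finset.univ g]
    refine Finset.sum_congr rfl fun j _ => ?_
    rw [hmean, abs_mul, Real.mul_rpow (abs_nonneg _) (abs_nonneg _),
      abs_of_nonneg (Real.rpow_nonneg (hΩ j) _), rp _ (hΩ j), hΩdef, Finset.sum_mul]
    refine Finset.sum_congr rfl fun k hk => ?_
    rw [(Finset.mem_filter.1 hk).2, abs_mul, Real.mul_rpow (abs_nonneg _) (abs_nonneg _),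
      abs_of_nonneg (Real.rpow_nonneg (hω k) _), rp _ (hω k)]
  have e2 : (∑ k, |ω k ^ (1 / p) * (u k - a (g k))| ^ p) ^ (1 / p) ≤
      δ * (∑ k, ω k) ^ (1 / p) := by
    have : δ * (∑ k, ω k) ^ (1 / p) = (∑ k, (ω k ^ (1 / p) * δ) ^ p) ^ (1 / p) := by
      have h : ∀ k, (ω k ^ (1 / p) * δ) ^ p = ω k * δ ^ p := fun k => by
        rw [Real.mul_rpow (Real.rpow_nonneg (hω k) _) hδ, rp _ (hω k)]
      simp only [h]
      rw [← Finset.sum_mul, Real.mul_rpow (Finset.sum_nonneg fun k _ => hω k) (by positivity),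
        ← Real.rpow_mul hδ, mul_one_div_cancel hp.ne', Real.rpow_one, mul_comm]
    rw [this]
    refine Real.rpow_le_rpow (by positivity) (Finset.sum_le_sum fun k _ =>
      Real.rpow_le_rpow (abs_nonneg _) ?_ hp.le) (by positivity)
    rw [abs_mul, abs_of_nonneg (Real.rpow_nonneg (hω k) _)]
    exact hclose k
  rw [e1] at hmink
  refine le_trans (le_of_eq ?_) (hmink.trans (by gcongr; exact le_rfl))
  unfold lpNorm
  congr! 4 with k
  ring

/-- A finite partition of a cube into pieces of small diameter, the number of pieces depending
only on the dimension and the diameter. -/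
theorem exists_cube_partition (n : ℕ) {δ : ℝ} (hδ : 0 < δ) :
    ∃ (M : ℕ) (G : (Fin n → ℝ) → Fin M), ∀ u u' : Fin n → ℝ, (∀ i, |u i| ≤ 1) →
      (∀ i, |u' i| ≤ 1) → G u = G u' → ∀ i, |u i - u' i| ≤ δ := by
  classical
  let I := Finset.Icc ⌊-1 / δ⌋ ⌊1 / δ⌋
  let κ := Option (Fin n → I)
  have hI : ∀ t : ℝ, |t| ≤ 1 → ⌊t / δ⌋ ∈ I := fun t ht => by
    rw [abs_le] at ht
    refine Finset.mem_Icc.2 ⟨Int.floor_le_floor ?_, Int.floor_le_floor ?_⟩ <;> gcongr <;> linarith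
  let G : (Fin n → ℝ) → κ := fun u =>
    if h : ∀ i, |u i| ≤ 1 then some fun i => ⟨⌊u i / δ⌋, hI _ (h i)⟩ else none
  refine ⟨Fintype.card κ, fun u => Fintype.equivFin κ (G u), fun u u' hu hu' h i => ?_⟩
  have h := (Fintype.equivFin κ).injective h
  simp only [G, dif_pos hu, dif_pos hu'] at h
  have h := Option.some.inj h
  have h := Int.abs_sub_lt_one_of_floor_eq_floor (Subtype.mk.inj (congrFun h i))
  rw [← sub_div, abs_div, abs_of_pos hδ, div_lt_one hδ] at h
  exact h.le

/-- Finitely many vectors of `ℓ_p^m` can be compressed, almost isometrically on these vectors, to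
`ℓ_p^M` with `M` independent of `m`. -/
theorem exists_lp_compression {p : ℝ} (hp : 1 < p) (n : ℕ) {δ : ℝ} (hδ : 0 < δ) :
    ∃ M : ℕ, ∀ (m : ℕ) (r : Fin n → Fin m → ℝ), ∃ A : (Fin m → ℝ) →ₗ[ℝ] (Fin M → ℝ),
      (∀ z, lpNorm p (A z) ≤ lpNorm p z) ∧
      ∀ i, lpNorm p (r i) ≤ lpNorm p (A (r i)) + δ * (∑ i, lpNorm p (r i) ^ p) ^ (1 / p) := by
  obtain ⟨M, G, hG⟩ := exists_cube_partition n hδ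
  have hpq := Real.HolderConjugate.conjExponent hp
  have hp0 := hpq.pos
  refine ⟨M, fun m r => ?_⟩
  let ω : Fin m → ℝ := fun k => ∑ i, |r i k| ^ p
  have hω : ∀ k, 0 ≤ ω k := fun k => by positivity
  have hr : ∀ i k, |r i k| ≤ ω k ^ (1 / p) := fun i k => abs_le_lpNorm hp0 (fun i => r i k) i
  let u : Fin m → Fin n → ℝ := fun k i => r i k / ω k ^ (1 / p)
  have hu : ∀ k i, |u k i| ≤ 1 := fun k i => by
    simp only [u, abs_div, abs_of_nonneg (Real.rpow_nonneg (hω k) _)]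
    exact div_le_one_of_le₀ (hr i k) (by positivity)
  refine ⟨blockMean p.conjExponent (fun k => G (u k)) ω,
    lpNorm_blockMean_le hpq _ hω, fun i => ?_⟩
  have h := lpNorm_le_lpNorm_blockMean_add hpq (fun k => G (u k)) hω (fun k => u k i) hδ.le
    fun k l hkl => hG _ _ (hu k) (hu l) hkl i
  have e : (fun k => ω k ^ (1 / p) * u k i) = r i := by
    ext k
    by_cases h0 : ω k ^ (1 / p) = 0
    · have := hr i k
      rw [h0] at this ⊢
      rw [zero_mul, abs_nonpos_iff.1 this]
    · exact mul_div_cancel₀ _ h0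
  rw [e] at h
  simp only [lpNorm_rpow hp0]
  rwa [Finset.sum_comm]

theorem IsLpSpaceWith.exists_embedding {p lam : ℝ} {Y : Type*}
    [NormedAddCommGroup Y] [NormedSpace ℝ Y] (hp : 0 < p) (hlam : 0 ≤ lam)
    (hY : IsLpSpaceWith p lam Y) (E : Submodule ℝ Y) [FiniteDimensional ℝ E] :
    ∃ (m : ℕ) (v : Y →ₗ[ℝ] (Fin m → ℝ)),
      ∀ y ∈ E, ‖y‖ ≤ lpNorm p (v y) ∧ lpNorm p (v y) ≤ lam * ‖y‖ := by
  obtain ⟨Y₀, hE, -, v, a, b, ha, hb, hab⟩ := hY E inferInstance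
  obtain ⟨V, hV⟩ := LinearMap.exists_extend v.toLinearMap
  refine ⟨_, max b 0 • V, fun y hy => ?_⟩
  have hVy : V y = v ⟨y, hE hy⟩ := LinearMap.congr_fun hV ⟨y, hE hy⟩
  rw [LinearMap.smul_apply, lpNorm_smul hp (le_max_right _ _), hVy]
  have h1 := hb (v ⟨y, hE hy⟩)
  have h2 := ha ⟨y, hE hy⟩
  have h3 := lpNorm_nonneg p (v ⟨y, hE hy⟩)
  rw [v.symm_apply_apply] at h1
  simp only [Submodule.coe_norm] at h1 h2
  refine ⟨h1.trans (mul_le_mul_of_nonneg_right (le_max_left _ _) h3), ?_⟩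
  rcases le_total b 0 with h | h
  · rw [max_eq_right h, zero_mul]; positivity
  · rw [max_eq_left h]
    calc b * lpNorm p (v ⟨y, hE hy⟩) ≤ b * (a * ‖y‖) := by gcongr
      _ = a * b * ‖y‖ := by ring
      _ ≤ lam * ‖y‖ := by gcongr

open Filter Topology in
/-- A pointwise bounded family of linear maps into `ℝ^M` that eventually satisfies closed
conditions has a linear limit. -/
theorem exists_linear_ultralimit {Y α : Type*} [AddCommGroup Y] [Module ℝ Y] {M : ℕ}
    (U : Ultrafilter α) (B : α → Y →ₗ[ℝ] (Fin M → ℝ)) (c : Y → ℝ)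
    (hB : ∀ y, ∀ᶠ s in (U : Filter α), ∀ j, |B s y j| ≤ c y) :
    ∃ L : Y →ₗ[ℝ] (Fin M → ℝ), ∀ y, Tendsto (fun s => B s y) U (𝓝 (L y)) := by
  have hex : ∀ y, ∃ l, Tendsto (fun s => B s y) U (𝓝 l) := by
    intro y
    obtain ⟨l, -, hl⟩ := (isCompact_univ_pi fun _ : Fin M =>
      isCompact_Icc (a := -c y) (b := c y)).ultrafilter_le_nhds' (U.map fun s => B s y)
      (by
        change ∀ᶠ s in (U : Filter α), B s y ∈ _
        filter_upwards [hB y] with s hs j _ using abs_le.1 (hs j))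
    exact ⟨l, hl⟩
  choose L hL using hex
  exact ⟨{ toFun := L
           map_add' := fun y z => tendsto_nhds_unique (hL (y + z))
             (by simpa using (hL y).add (hL z))
           map_smul' := fun t y => tendsto_nhds_unique (hL (t • y))
             (by simpa using (hL y).const_smul t) }, hL⟩

open Filter Topology in
/-- Finitely many vectors of an `L_p`-space can be embedded in some `ℓ_p^M`, up to a small error,
by a map that is defined and bounded on the whole space. -/
theorem IsLpSpaceWith.exists_global_embedding {p lam : ℝ} {Y : Type*}
    [NormedAddCommGroup Y] [NormedSpace ℝ Y] (hp : 1 < p) (hlam : 0 ≤ lam)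
    (hY : IsLpSpaceWith p lam Y) {n : ℕ} (y : Fin n → Y) {η : ℝ} (hη : 0 < η) :
    ∃ (M : ℕ) (ψ : Fin M → (Y →L[ℝ] ℝ)), (∀ z, lpNorm p (fun j => ψ j z) ≤ lam * ‖z‖) ∧
      ∀ i, ‖y i‖ ≤ lpNorm p (fun j => ψ j (y i)) + η := by
  classical
  have hp0 : 0 < p := by linarith
  set S := (∑ i, (lam * ‖y i‖) ^ p) ^ (1 / p) with hS
  have hS0 : 0 ≤ S := by positivity
  set δ := η / (S + 1) with hδ
  have hδ0 : 0 < δ := by positivity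
  obtain ⟨M, hM⟩ := exists_lp_compression hp n hδ0
  have hfin : ∀ s : Finset Y, ∃ B : Y →ₗ[ℝ] (Fin M → ℝ),
      (∀ z ∈ s, lpNorm p (B z) ≤ lam * ‖z‖) ∧ ∀ i, ‖y i‖ ≤ lpNorm p (B (y i)) + η := by
    intro s
    let E := Submodule.span ℝ ((s ∪ Finset.univ.image y : Finset Y) : Set Y)
    have hsE : ∀ z ∈ s, z ∈ E := fun z hz => Submodule.subset_span (by simp [hz])
    have hyE : ∀ i, y i ∈ E := fun i => Submodule.subset_span (by simp)
    obtain ⟨m, v, hv⟩ := hY.exists_embedding hp0 hlam E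
    obtain ⟨A, hA, hA'⟩ := hM m fun i => v (y i)
    refine ⟨A ∘ₗ v, fun z hz => (hA _).trans (hv z (hsE z hz)).2, fun i => ?_⟩
    refine ((hv _ (hyE i)).1.trans (hA' i)).trans (add_le_add le_rfl ?_)
    have : (∑ i, lpNorm p (v (y i)) ^ p) ^ (1 / p) ≤ S := by
      refine Real.rpow_le_rpow (Finset.sum_nonneg fun i _ =>
        Real.rpow_nonneg (lpNorm_nonneg _ _) _) (Finset.sum_le_sum fun i _ =>
        Real.rpow_le_rpow (lpNorm_nonneg _ _) (hv _ (hyE i)).2 hp0.le) (by positivity)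
    calc δ * _ ≤ δ * (S + 1) := by gcongr; linarith
      _ = η := div_mul_cancel₀ _ (by positivity)
  choose B hB hB' using hfin
  let U : Ultrafilter (Finset Y) := Ultrafilter.of atTop
  have hev : ∀ z, ∀ᶠ s in (U : Filter (Finset Y)), lpNorm p (B s z) ≤ lam * ‖z‖ := fun z =>
    Ultrafilter.of_le atTop <| by
      filter_upwards [eventually_ge_atTop {z}] with s hs using hB s z (hs (by simp))
  obtain ⟨L, hL⟩ := exists_linear_ultralimit U B (fun z => lam * ‖z‖) fun z => by
    filter_upwards [hev z] with s hs j using (abs_le_lpNorm hp0 _ j).trans hs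
  have hLp : ∀ z, Tendsto (fun s => lpNorm p (B s z)) U (𝓝 (lpNorm p (L z))) := fun z =>
    ((continuous_lpNorm hp0).tendsto _).comp (hL z)
  have hup : ∀ z, lpNorm p (L z) ≤ lam * ‖z‖ := fun z => le_of_tendsto (hLp z) (hev z)
  refine ⟨M, fun j => (LinearMap.proj j ∘ₗ L).mkContinuous lam fun z =>
    (abs_le_lpNorm hp0 (L z) j).trans (hup z), hup, fun i => ?_⟩
  exact ge_of_tendsto ((hLp (y i)).add_const η) (Eventually.of_forall fun s => hB' s i)

/-- The weak `ℓ_p` norm of functionals `ψ j` is at most the norm of the map `z ↦ (ψ j z)` into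
`ℓ_p`. -/
theorem weakNorm_le_of_forall {p : ℝ} (hp : 1 < p) {Y : Type*} [NormedAddCommGroup Y]
    [NormedSpace ℝ Y] {M : ℕ} (ψ : Fin M → (Y →L[ℝ] ℝ)) {lam : ℝ} (hlam : 0 ≤ lam)
    (hψ : ∀ z, lpNorm p (fun j => ψ j z) ≤ lam * ‖z‖) : weakNorm p ψ ≤ lam := by
  have hpq := Real.HolderConjugate.conjExponent hp
  set q := p.conjExponent
  have hp0 := hpq.pos
  have hq0 := hpq.symm.pos
  refine Real.iSup_le (fun ⟨φ, hφ⟩ => ?_) hlam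
  set t : Fin M → ℝ := fun j => φ (ψ j) with ht
  set A := ∑ j, |t j| ^ p with hA
  change A ^ (1 / p) ≤ lam
  have hA0 : 0 ≤ A := by positivity
  rcases hA0.eq_or_lt with h | h
  · rw [← h, Real.zero_rpow (by positivity)]; exact hlam
  have hsplit : A ^ (1 / q) * A ^ (1 / p) = A := by
    rw [← Real.rpow_add h, add_comm, one_div, one_div, hpq.inv_add_inv_eq_one, Real.rpow_one]
  set c : Fin M → ℝ := fun j => SignType.sign (t j) * |t j| ^ (p - 1) with hc
  have hcabs : ∀ j, |c j| ^ q ≤ |t j| ^ p := fun j => by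
    rw [← hpq.sub_one_mul_conj, Real.rpow_mul (abs_nonneg _)]
    refine Real.rpow_le_rpow (abs_nonneg _) ?_ hq0.le
    rw [hc, abs_mul, abs_of_nonneg (Real.rpow_nonneg (abs_nonneg (t j)) _)]
    refine mul_le_of_le_one_left (by positivity) ?_
    rcases lt_trichotomy (t j) 0 with h | h | h <;> simp [h]
  have hnorm : ‖∑ j, c j • ψ j‖ ≤ lam * A ^ (1 / q) := by
    refine ContinuousLinearMap.opNorm_le_bound _ (by positivity) fun z => ?_
    have hz := Real.inner_le_Lp_mul_Lq Finset.univ (fun j => |ψ j z|) (fun j => |c j|) hpq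
    simp only [abs_abs] at hz
    calc ‖(∑ j, c j • ψ j) z‖ ≤ ∑ j, |ψ j z| * |c j| := by
          simp only [_root_.sum_apply, _root_.smul_apply, smul_eq_mul,
            Real.norm_eq_abs]
          refine (Finset.abs_sum_le_sum_abs _ _).trans (le_of_eq ?_)
          simp only [abs_mul, mul_comm]
      _ ≤ lpNorm p (fun j => ψ j z) * (∑ j, |c j| ^ q) ^ (1 / q) := hz
      _ ≤ (lam * ‖z‖) * A ^ (1 / q) := by
          gcongr
          · exact hψ z
          · exact Finset.sum_le_sum fun j _ => hcabs j
      _ = lam * A ^ (1 / q) * ‖z‖ := by ring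
  have hφA : φ (∑ j, c j • ψ j) = A := by
    simp only [map_sum, map_smul, smul_eq_mul, hA]
    refine Finset.sum_congr rfl fun j _ => ?_
    change SignType.sign (t j) * |t j| ^ (p - 1) * t j = |t j| ^ p
    rw [mul_right_comm, sign_mul_self, ← Real.rpow_one_add' (abs_nonneg _) (by linarith)]
    congr 1; ring
  have hle : A ≤ lam * A ^ (1 / q) := by
    calc A = φ (∑ j, c j • ψ j) := hφA.symm
      _ ≤ ‖φ (∑ j, c j • ψ j)‖ := le_abs_self _
      _ ≤ 1 * ‖∑ j, c j • ψ j‖ := φ.le_of_opNorm_le hφ _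
      _ ≤ _ := by rwa [one_mul]
  refine le_of_mul_le_mul_left ?_ (Real.rpow_pos_of_pos h (1 / q))
  rw [hsplit, mul_comm]
  exact hle

theorem sum_abs_le_weakNorm_one {X : Type*} [NormedAddCommGroup X] [NormedSpace ℝ X] {n : ℕ}
    (x : Fin n → X) (f : X →L[ℝ] ℝ) : ∑ i, |f (x i)| ≤ ‖f‖ * weakNorm 1 x := by
  have hbdd : BddAbove (Set.range fun φ : {φ : X →L[ℝ] ℝ // ‖φ‖ ≤ 1} =>
      (∑ i, |φ.1 (x i)| ^ (1 : ℝ)) ^ (1 / (1 : ℝ))) := by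
    refine ⟨∑ i, ‖x i‖, ?_⟩
    rintro _ ⟨φ, rfl⟩
    simp only [Real.rpow_one, div_one]
    exact Finset.sum_le_sum fun i _ => φ.1.le_of_opNorm_le_of_le φ.2 le_rfl |>.trans (one_mul _).le
  rcases (norm_nonneg f).eq_or_lt with h | h
  · rw [norm_eq_zero.1 h.symm]; simp
  have hmem : ‖‖f‖⁻¹ • f‖ ≤ 1 := by rw [norm_smul, norm_inv, norm_norm, inv_mul_cancel₀ h.ne']
  have := le_ciSup hbdd ⟨‖f‖⁻¹ • f, hmem⟩
  simp only [Real.rpow_one, div_one, _root_.smul_apply, smul_eq_mul, abs_mul,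
    abs_inv, abs_norm, ← Finset.mul_sum] at this
  rw [inv_mul_le_iff₀ h] at this
  simpa only [weakNorm, Real.rpow_one, div_one] using this

theorem sum_norm_le_radAvg {F : Type*} [NormedAddCommGroup F] [NormedSpace ℝ F] {n : ℕ}
    (y : Fin n → F) :
    ∑ ε : Fin n → Bool, ‖∑ i, (if ε i then (1 : ℝ) else -1) • y i‖ ≤ 2 ^ n * radAvg y := by
  have h := sq_sum_le_card_mul_sum_sq (s := Finset.univ)
    (f := fun ε : Fin n → Bool => ‖∑ i, (if ε i then (1 : ℝ) else -1) • y i‖)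
  simp only [Finset.card_univ, Fintype.card_fun, Fintype.card_bool, Fintype.card_fin] at h
  push_cast at h
  refine (sq_le_sq₀ (by positivity) (by unfold radAvg; positivity)).1 ?_
  rw [mul_pow, radAvg, Real.sq_sqrt (by positivity)]
  refine h.trans (le_of_eq ?_)
  field_simp

theorem sum_lpNorm_le {X Y : Type*} [NormedAddCommGroup X] [NormedSpace ℝ X]
    [NormedAddCommGroup Y] [NormedSpace ℝ Y] {p : ℝ} (hp : 2 ≤ p) (T : X →L[ℝ] Y) {n M : ℕ}
    (x : Fin n → X) (ψ : Fin M → (Y →L[ℝ] ℝ)) :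
    ∑ i, lpNorm p (fun j => ψ j (T (x i))) ≤
      9 / 5 * (radAvg fun j => (ψ j).comp T) * weakNorm 1 x := by
  have hw : 0 ≤ weakNorm 1 x := Real.iSup_nonneg fun φ => by positivity
  have key : 2 ^ M * (5 / 9 * ∑ i, lpNorm p (fun j => ψ j (T (x i)))) ≤
      2 ^ M * (radAvg (fun j => (ψ j).comp T) * weakNorm 1 x) := by
    calc 2 ^ M * (5 / 9 * ∑ i, lpNorm p (fun j => ψ j (T (x i))))
        = ∑ i, 2 ^ M * (5 / 9 * lpNorm p (fun j => ψ j (T (x i)))) := by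
          rw [Finset.mul_sum, Finset.mul_sum]
      _ ≤ ∑ i, ∑ ε, |radSum (fun j => ψ j (T (x i))) ε| := by
          refine Finset.sum_le_sum fun i _ => le_trans ?_ (khintchine _)
          gcongr
          exact lpNorm_le_sqrt hp _
      _ = ∑ ε : Fin M → Bool, ∑ i,
            |(∑ j, (if ε j then (1 : ℝ) else -1) • (ψ j).comp T) (x i)| := by
          rw [Finset.sum_comm]
          simp only [radSum, _root_.sum_apply, _root_.smul_apply, smul_eq_mul,
            ContinuousLinearMap.comp_apply]
      _ ≤ ∑ ε : Fin M → Bool,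
            ‖∑ j, (if ε j then (1 : ℝ) else -1) • (ψ j).comp T‖ * weakNorm 1 x :=
          Finset.sum_le_sum fun ε _ => sum_abs_le_weakNorm_one x _
      _ ≤ _ := by
          rw [← Finset.sum_mul, ← mul_assoc]
          exact mul_le_mul_of_nonneg_right (sum_norm_le_radAvg _) hw
  have := le_of_mul_le_mul_left key (by positivity)
  linarith

/-- If `X` is a real Banach space, `2 ≤ p < ∞`, `Y` is a real Banach space which is an
`L_p`-space, and `T : X → Y` is a bounded linear operator whose adjoint `T* : Y* → X*`,
`ψ ↦ ψ ∘ T`, is almost `p`-summing, then `T` is absolutely `1`-summing. -/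
theorem kwapien_Lp {X Y : Type*} [NormedAddCommGroup X] [NormedSpace ℝ X] [CompleteSpace X]
    [NormedAddCommGroup Y] [NormedSpace ℝ Y] [CompleteSpace Y]
    (p : ℝ) (hp : 2 ≤ p) (hY : ∃ lam : ℝ, 1 < lam ∧ IsLpSpaceWith p lam Y)
    (T : X →L[ℝ] Y)
    (hadj : AlmostSumming p (fun ψ : Y →L[ℝ] ℝ => ψ.comp T)) :
    AbsolutelyOneSumming (fun x => T x) := by
  obtain ⟨lam, hlam, hY⟩ := hY
  obtain ⟨C, hC, hadj⟩ := hadj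
  refine ⟨9 / 5 * (C * lam), by positivity, fun n x => le_of_forall_pos_le_add fun η hη => ?_⟩
  obtain ⟨M, ψ, hψ, hψ'⟩ := hY.exists_global_embedding (by linarith) (by linarith)
    (fun i => T (x i)) (η := η / (n + 1)) (by positivity)
  have hw : 0 ≤ weakNorm 1 x := Real.iSup_nonneg fun φ => by positivity
  have hrad : (radAvg fun j => (ψ j).comp T) ≤ C * lam := (hadj M ψ).trans <|
    mul_le_mul_of_nonneg_left (weakNorm_le_of_forall (by linarith) ψ (by linarith) hψ) hC
  calc ∑ i, ‖T (x i)‖ ≤ ∑ i : Fin n, (lpNorm p (fun j => ψ j (T (x i))) + η / (n + 1)) :=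
        Finset.sum_le_sum fun i _ => hψ' i
    _ = ∑ i, lpNorm p (fun j => ψ j (T (x i))) + n * (η / (n + 1)) := by
        simp [Finset.sum_add_distrib]
    _ ≤ 9 / 5 * (C * lam) * weakNorm 1 x + η := by
        refine add_le_add ((sum_lpNorm_le hp T x ψ).trans ?_) ?_
        · gcongr
        · rw [mul_div_assoc', div_le_iff₀ (by positivity)]
          nlinarith
end

section
/- Let X be a pointed metric space with base point 0 and let H be a real Hilbert space. Let f : X → H be a map with f(0) = 0 such that y* ∘ f is Lipschitz for every y* ∈ H*, and let f^a : H* → X^# denote the linear map f^a(y*) = y* ∘ f. Let K be a set of real-valued functions on X, let R : K × X × X → [0,∞) and S : X × X → [0,∞) satisfy: (I) S(x,q) ≤ ‖f(x) − f(q)‖ for all x, q ∈ X; and (II) every g ∈ f^a(H*) with Lipschitz norm at most 1 belongs to K and satisfies |g(x) − g(q)| ≤ R(g,x,q) for all x, q ∈ X. If f^a : H* → X^# is absolutely q-summing for some 1 ≤ q < ∞, then there exists C ≥ 0 such that ∑_{i=1}^n S(xᵢ,qᵢ) ≤ C · sup_{g ∈ K} ∑_{i=1}^n R(g,xᵢ,qᵢ)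 for every n and all x₁,…,xₙ,q₁,…,qₙ ∈ X. -/
open scoped BigOperators NNReal

/-- The Lipschitz norm of `g : X → ℝ`, i.e. the norm in `X^#`. -/
noncomputable def lipNorm {X : Type*} [MetricSpace X] (g : X → ℝ) : ℝ :=
  sInf {K : ℝ | 0 ≤ K ∧ ∀ x y : X, |g x - g y| ≤ K * dist x y}

/-- A map `u : E → X^#` (into functions `X → ℝ` measured with the Lipschitz norm) is
absolutely `q`-summing. -/
def AbsSummingIntoLip (q : ℝ) {E X : Type*} [NormedAddCommGroup E] [NormedSpace ℝ E]
    [MetricSpace X] (u : E → X → ℝ) : Prop :=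
  ∃ C : ℝ, 0 ≤ C ∧ ∀ (n : ℕ) (h : Fin n → E),
    (∑ i, lipNorm (u (h i)) ^ q) ^ (1 / q) ≤ C * weakNorm q h

/-- The Rademacher sum `∑ j, ε j * a j` for a vector `ε` of signs. -/
def signSum {ι : Type*} [Fintype ι] (a : ι → ℝ) (ε : ι → ℤˣ) : ℝ :=
  ∑ j, ((ε j : ℤ) : ℝ) * a j

theorem exists_rpow_le_mul_exp {q : ℝ} (hq : 0 ≤ q) :
    ∃ A : ℝ, 0 ≤ A ∧ ∀ t : ℝ, 0 ≤ t → t ^ q ≤ A * Real.exp t := by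
  refine ⟨1 + (⌈q⌉₊).factorial, by positivity, fun t ht => ?_⟩
  have h := Real.pow_div_factorial_le_exp t ht ⌈q⌉₊
  rw [div_le_iff₀ (by positivity)] at h
  have h1 := Real.one_le_exp ht
  have h2 : t ^ q ≤ 1 + t ^ ⌈q⌉₊ := by
    rcases le_total t 1 with h' | h'
    · exact (Real.rpow_le_one ht h' hq).trans (by linarith [pow_nonneg ht ⌈q⌉₊])
    · have := Real.rpow_le_rpow_of_exponent_le h' (Nat.le_ceil q)
      rw [Real.rpow_natCast] at this
      linarith
  linarith

section Khintchine

variable {ι : Type*} [Fintype ι]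

theorem signSum_smul (c : ℝ) (a : ι → ℝ) (ε : ι → ℤˣ) :
    signSum (fun j => c * a j) ε = c * signSum a ε := by
  simp only [signSum, Finset.mul_sum]
  exact Finset.sum_congr rfl fun j _ => by ring

variable [DecidableEq ι]

theorem sum_exp_signSum (a : ι → ℝ) :
    ∑ ε : ι → ℤˣ, Real.exp (signSum a ε) = ∏ j, (2 * Real.cosh (a j)) := by
  have h (j : ι) : 2 * Real.cosh (a j) = ∑ u : ℤˣ, Real.exp (((u : ℤ) : ℝ) * a j) := by
    rw [UnitsInt.univ, Finset.sum_pair (by decide), Real.cosh_eq]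
    simp
    ring
  simp_rw [h, Finset.prod_univ_sum, Fintype.piFinset_univ, signSum, Real.exp_sum]

theorem sum_exp_signSum_le {a : ι → ℝ} (ha : ∑ j, a j ^ 2 ≤ 1) :
    ∑ ε : ι → ℤˣ, Real.exp (signSum a ε) ≤ 2 * Fintype.card (ι → ℤˣ) := by
  have hhalf : Real.exp (1 / 2) ≤ 2 := by
    have h1 : Real.exp (1 / 2) * Real.exp (1 / 2) = Real.exp 1 := by
      rw [← Real.exp_add]; norm_num
    nlinarith [Real.exp_one_lt_d9, Real.exp_pos (1 / 2)]
  calc ∑ ε : ι → ℤˣ, Real.exp (signSum a ε) = ∏ j, (2 * Real.cosh (a j)) := sum_exp_signSum a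
    _ ≤ ∏ j, (2 * Real.exp (a j ^ 2 / 2)) :=
        Finset.prod_le_prod (fun j _ => by positivity)
          fun j _ => by gcongr; exact Real.cosh_le_exp_half_sq _
    _ = Fintype.card (ι → ℤˣ) * Real.exp ((∑ j, a j ^ 2) / 2) := by
        rw [Finset.prod_mul_distrib, ← Real.exp_sum, Finset.sum_div]
        simp
    _ ≤ Fintype.card (ι → ℤˣ) * 2 := by
        gcongr
        exact (Real.exp_le_exp.2 (by linarith)).trans hhalf
    _ = 2 * Fintype.card (ι → ℤˣ) := mul_comm _ _

theorem sum_exp_abs_signSum_le {a : ι → ℝ} (ha : ∑ j, a j ^ 2 ≤ 1) :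
    ∑ ε : ι → ℤˣ, Real.exp |signSum a ε| ≤ 4 * Fintype.card (ι → ℤˣ) := by
  have h2 := sum_exp_signSum_le (a := fun j => (-1) * a j) (by simpa using ha)
  simp only [signSum_smul] at h2
  calc ∑ ε : ι → ℤˣ, Real.exp |signSum a ε|
      ≤ ∑ ε : ι → ℤˣ, (Real.exp (signSum a ε) + Real.exp (-1 * signSum a ε)) := by
        refine Finset.sum_le_sum fun ε _ => ?_
        rw [neg_one_mul]
        exact Real.exp_abs_le _
    _ ≤ 4 * Fintype.card (ι → ℤˣ) := by
        rw [Finset.sum_add_distrib]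
        linarith [sum_exp_signSum_le ha]

theorem sum_sign_mul_sign (i j : ι) :
    ∑ ε : ι → ℤˣ, ((ε i : ℤ) : ℝ) * ((ε j : ℤ) : ℝ)
      = if i = j then (Fintype.card (ι → ℤˣ) : ℝ) else 0 := by
  split_ifs with hij
  · subst hij
    have h (u : ℤˣ) : ((u : ℤ) : ℝ) * ((u : ℤ) : ℝ) = 1 := by
      exact_mod_cast Int.units_coe_mul_self u
    simp [h]
  · have h := Fintype.sum_equiv (Equiv.mulLeft (Pi.mulSingle i (-1 : ℤˣ)))
      (fun ε : ι → ℤˣ => -(((ε i : ℤ) : ℝ) * ((ε j : ℤ) : ℝ)))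
      (fun ε => ((ε i : ℤ) : ℝ) * ((ε j : ℤ) : ℝ))
      (fun ε => by simp [Pi.mulSingle_eq_of_ne (Ne.symm hij)])
    rw [Finset.sum_neg_distrib] at h
    linarith

theorem sum_signSum_sq (a : ι → ℝ) :
    ∑ ε : ι → ℤˣ, signSum a ε ^ 2 = Fintype.card (ι → ℤˣ) * ∑ j, a j ^ 2 := by
  calc ∑ ε : ι → ℤˣ, signSum a ε ^ 2
      = ∑ ε : ι → ℤˣ, ∑ i, ∑ j, a i * a j * (((ε i : ℤ) : ℝ) * ((ε j : ℤ) : ℝ)) := by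
        refine Finset.sum_congr rfl fun ε _ => ?_
        rw [signSum, sq, Finset.sum_mul_sum]
        exact Finset.sum_congr rfl fun i _ => Finset.sum_congr rfl fun j _ => by ring
    _ = ∑ i, ∑ j, a i * a j * ∑ ε : ι → ℤˣ, ((ε i : ℤ) : ℝ) * ((ε j : ℤ) : ℝ) := by
        rw [Finset.sum_comm]
        refine Finset.sum_congr rfl fun i _ => ?_
        rw [Finset.sum_comm]
        simp_rw [Finset.mul_sum]
    _ = Fintype.card (ι → ℤˣ) * ∑ j, a j ^ 2 := by
        simp_rw [sum_sign_mul_sign, mul_ite, mul_zero, Finset.sum_ite_eq, Finset.mem_univ, if_true,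
          Finset.mul_sum]
        exact Finset.sum_congr rfl fun i _ => by ring

/-- Lower Khintchine inequality in `L¹` for unit vectors. -/
theorem card_le_sum_abs_signSum {a : ι → ℝ} (ha : ∑ j, a j ^ 2 = 1) :
    (Fintype.card (ι → ℤˣ) : ℝ) ≤ 28 * ∑ ε : ι → ℤˣ, |signSum a ε| := by
  have hpt (s : ℝ) : s ^ 2 ≤ 14 * |s| + 24 / 196 * Real.exp |s| := by
    have h4 := Real.pow_div_factorial_le_exp |s| (abs_nonneg s) 4
    norm_num [Nat.factorial] at h4
    rw [← sq_abs]
    have hs := abs_nonneg s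
    rcases le_total |s| 14 with h | h
    · nlinarith [Real.exp_pos |s|]
    · have : 196 * |s| ^ 2 ≤ |s| ^ 4 := by
        calc 196 * |s| ^ 2 ≤ |s| ^ 2 * |s| ^ 2 := by
              gcongr
              nlinarith
          _ = |s| ^ 4 := by ring
      linarith
  have h := Finset.sum_le_sum fun (ε : ι → ℤˣ) (_ : ε ∈ Finset.univ) => hpt (signSum a ε)
  rw [sum_signSum_sq, ha, Finset.sum_add_distrib, ← Finset.mul_sum, ← Finset.mul_sum] at h
  have hN : (0 : ℝ) ≤ Fintype.card (ι → ℤˣ) := Nat.cast_nonneg _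
  linarith [sum_exp_abs_signSum_le ha.le]

/-- Lower Khintchine inequality in `L¹`. -/
theorem card_mul_le_sum_abs_signSum {a : ι → ℝ} {r : ℝ} (hr : 0 ≤ r)
    (ha : ∑ j, a j ^ 2 = r ^ 2) :
    Fintype.card (ι → ℤˣ) * r ≤ 28 * ∑ ε : ι → ℤˣ, |signSum a ε| := by
  rcases hr.eq_or_lt with rfl | hr
  · simpa using Finset.sum_nonneg fun (ε : ι → ℤˣ) _ => abs_nonneg (signSum a ε)
  have h := card_le_sum_abs_signSum (a := fun j => r⁻¹ * a j) (by
    simp_rw [mul_pow, ← Finset.mul_sum, ha]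
    field_simp)
  simp_rw [signSum_smul, abs_mul, abs_of_pos (inv_pos.2 hr), ← Finset.mul_sum] at h
  calc Fintype.card (ι → ℤˣ) * r
      ≤ 28 * (r⁻¹ * ∑ ε : ι → ℤˣ, |signSum a ε|) * r := by gcongr
    _ = 28 * ∑ ε : ι → ℤˣ, |signSum a ε| := by field_simp

/-- Upper Khintchine inequality in `L^q`, with a constant depending only on `q`. -/
theorem sum_abs_signSum_rpow_le {q A : ℝ} (hA : 0 ≤ A)
    (hexp : ∀ t : ℝ, 0 ≤ t → t ^ q ≤ A * Real.exp t) {a : ι → ℝ} (ha : ∑ j, a j ^ 2 ≤ 1) :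
    ∑ ε : ι → ℤˣ, |signSum a ε| ^ q ≤ Fintype.card (ι → ℤˣ) * (4 * A) := by
  calc ∑ ε : ι → ℤˣ, |signSum a ε| ^ q
      ≤ ∑ ε : ι → ℤˣ, A * Real.exp |signSum a ε| :=
        Finset.sum_le_sum fun ε _ => hexp _ (abs_nonneg _)
    _ ≤ A * (4 * Fintype.card (ι → ℤˣ)) := by
        rw [← Finset.mul_sum]
        exact mul_le_mul_of_nonneg_left (sum_exp_abs_signSum_le ha) hA
    _ = Fintype.card (ι → ℤˣ) * (4 * A) := by ring

end Khintchine

section Lipschitz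

variable {X : Type*} [MetricSpace X]

theorem lipNorm_nonneg (g : X → ℝ) : 0 ≤ lipNorm g :=
  Real.sInf_nonneg fun _ h => h.1

theorem abs_sub_le_lipNorm_mul {g : X → ℝ} (hg : ∃ L : ℝ≥0, LipschitzWith L g) (x y : X) :
    |g x - g y| ≤ lipNorm g * dist x y := by
  rcases eq_or_ne x y with rfl | hxy
  · simp
  have hd := dist_pos.2 hxy
  obtain ⟨L, hL⟩ := hg
  rw [← div_le_iff₀ hd]
  refine le_csInf ⟨L, L.2, fun a b => ?_⟩ fun c hc => (div_le_iff₀ hd).2 (hc.2 x y)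
  simpa [Real.dist_eq] using hL.dist_le_mul a b

/-- Absolute summability, for families indexed by an arbitrary finite type and in terms of
`q`-th powers. -/
theorem sum_lipNorm_rpow_le {E : Type*} [NormedAddCommGroup E] [NormedSpace ℝ E]
    {q C : ℝ} (hq : 1 ≤ q) (hC : 0 ≤ C) {u : E → X → ℝ}
    (hu : ∀ (n : ℕ) (h : Fin n → E),
      (∑ i, lipNorm (u (h i)) ^ q) ^ (1 / q) ≤ C * weakNorm q h)
    {ι : Type*} [Fintype ι] (h : ι → E) {W : ℝ} (hW : 0 ≤ W)
    (hh : ∀ φ : E →L[ℝ] ℝ, ‖φ‖ ≤ 1 → ∑ i, |φ (h i)| ^ q ≤ W) :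
    ∑ i, lipNorm (u (h i)) ^ q ≤ C ^ q * W := by
  have hq0 : 0 < q := by linarith
  let e := (Fintype.equivFin ι).symm
  have hw : weakNorm q (fun i => h (e i)) ≤ W ^ (1 / q) := by
    have : Nonempty {φ : E →L[ℝ] ℝ // ‖φ‖ ≤ 1} := ⟨⟨0, by simp⟩⟩
    refine ciSup_le fun φ => ?_
    rw [e.sum_comp fun i => |φ.1 (h i)| ^ q]
    exact Real.rpow_le_rpow (Finset.sum_nonneg fun i _ => by positivity) (hh φ.1 φ.2)
      (by positivity)
  have hs := (hu _ fun i => h (e i)).trans (mul_le_mul_of_nonneg_left hw hC)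
  rw [e.sum_comp fun i => lipNorm (u (h i)) ^ q] at hs
  have h0 : 0 ≤ ∑ i, lipNorm (u (h i)) ^ q :=
    Finset.sum_nonneg fun i _ => Real.rpow_nonneg (lipNorm_nonneg _) _
  have := Real.rpow_le_rpow (by positivity) hs hq0.le
  rwa [Real.mul_rpow hC (by positivity), ← Real.rpow_mul h0, ← Real.rpow_mul hW,
    one_div_mul_cancel hq0.ne', Real.rpow_one, Real.rpow_one] at this

end Lipschitz

section Hilbert

variable {H : Type*} [NormedAddCommGroup H] [InnerProductSpace ℝ H] {ι : Type*} [Fintype ι]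

/-- The random functional `∑ j, ε j • ⟪e j, ·⟫`. -/
noncomputable def signFunctional (e : ι → H) (ε : ι → ℤˣ) : H →L[ℝ] ℝ :=
  ∑ j, ((ε j : ℤ) : ℝ) • innerSL ℝ (e j)

theorem signFunctional_apply (e : ι → H) (ε : ι → ℤˣ) (v : H) :
    signFunctional e ε v = signSum (fun j => inner ℝ (e j) v) ε := by
  simp [signFunctional, signSum]

theorem map_signFunctional (φ : (H →L[ℝ] ℝ) →L[ℝ] ℝ) (e : ι → H) (ε : ι → ℤˣ) :
    φ (signFunctional e ε) = signSum (fun j => φ (innerSL ℝ (e j))) ε := by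
  simp [signFunctional, signSum, map_sum]

theorem Orthonormal.sum_sq_apply_innerSL_le {e : ι → H} (he : Orthonormal ℝ e)
    {φ : (H →L[ℝ] ℝ) →L[ℝ] ℝ} (hφ : ‖φ‖ ≤ 1) : ∑ j, φ (innerSL ℝ (e j)) ^ 2 ≤ 1 := by
  set c : ι → ℝ := fun j => φ (innerSL ℝ (e j)) with hc
  set v : H := ∑ j, c j • e j with hv
  have hn : ‖v‖ ^ 2 = ∑ j, c j ^ 2 := by
    rw [← real_inner_self_eq_norm_sq, hv, he.inner_sum]
    simp [sq]
  have hφv : φ (innerSL ℝ v) = ‖v‖ ^ 2 := by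
    rw [hn, hv, map_sum, map_sum]
    refine Finset.sum_congr rfl fun j _ => ?_
    rw [map_smulₛₗ, map_smulₛₗ]
    simp [hc, sq]
  have hle : ‖v‖ ^ 2 ≤ ‖v‖ := by
    calc ‖v‖ ^ 2 ≤ ‖φ (innerSL ℝ v)‖ := by rw [hφv]; exact le_abs_self _
      _ ≤ ‖φ‖ * ‖innerSL ℝ v‖ := φ.le_opNorm _
      _ ≤ ‖v‖ := by
        rw [innerSL_apply_norm]
        exact mul_le_of_le_one_left (norm_nonneg _) hφ
  rw [← hn]
  nlinarith [norm_nonneg v]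

/-- A finite family lies in the span of a finite orthonormal family, so Parseval holds for it. -/
theorem exists_orthonormal_sum_sq_inner_eq (v : ι → H) :
    ∃ (m : ℕ) (e : Fin m → H), Orthonormal ℝ e ∧
      ∀ i, ∑ j, (inner ℝ (e j) (v i)) ^ 2 = ‖v i‖ ^ 2 := by
  let V := Submodule.span ℝ (Set.range v)
  have : FiniteDimensional ℝ V := FiniteDimensional.span_of_finite ℝ (Set.finite_range v)
  let b := stdOrthonormalBasis ℝ V
  refine ⟨Module.finrank ℝ V, fun j => b j, b.orthonormal.comp_linearIsometry V.subtypeₗᵢ,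
    fun i => ?_⟩
  have h := b.sum_sq_norm_inner_right ⟨v i, Submodule.subset_span ⟨i, rfl⟩⟩
  simpa using h

end Hilbert

/-- **Abstract Kwapień-type theorem.** Let `X` be a pointed metric space, `H` a real Hilbert
space, `f : X → H` with `f base = 0` such that `ψ ∘ f` is Lipschitz for every `ψ ∈ H*`; let
`f^a : H* → X^#` be `f^a(ψ) = ψ ∘ f`. If `R`, `S` satisfy (I) `S(x,q) ≤ ‖f(x) − f(q)‖`, and
(II) every `g ∈ f^a(H*)` of Lipschitz norm at most `1` lies in `K` and satisfies
`|g(x) − g(q)| ≤ R(g,x,q)`, and `f^a` is absolutely `q`-summing for some `1 ≤ q < ∞`, then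
there is `C ≥ 0` with `∑ S(xᵢ,qᵢ) ≤ C ⬝ sup_{g ∈ K} ∑ R(g,xᵢ,qᵢ)` (formulated via arbitrary
upper bounds `B`). -/
theorem abstract_kwapien {X H : Type*} [MetricSpace X] (base : X)
    [NormedAddCommGroup H] [InnerProductSpace ℝ H] [CompleteSpace H]
    (f : X → H) (hf0 : f base = 0)
    (hlip : ∀ ψ : H →L[ℝ] ℝ, ∃ L : ℝ≥0, LipschitzWith L (fun x => ψ (f x)))
    (K : Set (X → ℝ)) (R : (X → ℝ) → X → X → ℝ) (S : X → X → ℝ)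
    (hRnonneg : ∀ g ∈ K, ∀ x q : X, 0 ≤ R g x q)
    (hSnonneg : ∀ x q : X, 0 ≤ S x q)
    (hI : ∀ x q : X, S x q ≤ ‖f x - f q‖)
    (hII : ∀ ψ : H →L[ℝ] ℝ, LipschitzWith 1 (fun x => ψ (f x)) →
      (fun x => ψ (f x)) ∈ K ∧ ∀ x q : X, |ψ (f x) - ψ (f q)| ≤ R (fun x => ψ (f x)) x q)
    (hfa : ∃ q : ℝ, 1 ≤ q ∧
      AbsSummingIntoLip q (fun ψ : H →L[ℝ] ℝ => fun x => ψ (f x))) :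
    ∃ C : ℝ, 0 ≤ C ∧ ∀ (n : ℕ) (x q : Fin n → X) (B : ℝ),
      (∀ g ∈ K, ∑ i, R g (x i) (q i) ≤ B) →
      ∑ i, S (x i) (q i) ≤ C * B := by
  obtain ⟨p, hp, Cs, hCs, hsum⟩ := hfa
  obtain ⟨A, hA, hexp⟩ := exists_rpow_le_mul_exp (zero_le_one.trans hp)
  have hD : 0 ≤ Cs ^ p * (4 * A) := by positivity
  refine ⟨28 * (1 + Cs ^ p * (4 * A)), by positivity, fun n x q B hB => ?_⟩
  have hB0 : 0 ≤ B := by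
    have hz : LipschitzWith 1 (fun x => (0 : H →L[ℝ] ℝ) (f x)) := by
      simpa using LipschitzWith.const' (α := X) (K := 1) (0 : ℝ)
    exact (Finset.sum_nonneg fun i _ => hRnonneg _ (hII 0 hz).1 _ _).trans (hB _ (hII 0 hz).1)
  have hbound (ψ : H →L[ℝ] ℝ) :
      ∑ i, |ψ (f (x i) - f (q i))| ≤ lipNorm (fun x => ψ (f x)) * B := by
    have hL := abs_sub_le_lipNorm_mul (hlip ψ)
    rcases (lipNorm_nonneg fun x => ψ (f x)).eq_or_lt with h0 | hpos
    · rw [← h0] at hL ⊢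
      simp only [zero_mul] at hL ⊢
      exact Finset.sum_nonpos fun i _ => by rw [map_sub]; exact hL _ _
    · set L := lipNorm fun x => ψ (f x)
      have hlip1 : LipschitzWith 1 (fun x => (L⁻¹ • ψ) (f x)) := by
        refine LipschitzWith.of_dist_le_mul fun a b => ?_
        rw [Real.dist_eq]
        simp only [smul_apply, smul_eq_mul, ← mul_sub, abs_mul,
          abs_of_pos (inv_pos.2 hpos), NNReal.coe_one, one_mul]
        rw [inv_mul_le_iff₀ hpos]
        exact hL a b
      obtain ⟨hK, hR⟩ := hII _ hlip1
      have h := (Finset.sum_le_sum fun i (_ : i ∈ Finset.univ) => hR (x i) (q i)).trans (hB _ hK)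
      simp only [smul_apply, smul_eq_mul, ← mul_sub, abs_mul,
          abs_of_pos (inv_pos.2 hpos), ← Finset.mul_sum] at h
      rw [inv_mul_le_iff₀ hpos] at h
      simpa only [map_sub] using h
  set v : Fin n → H := fun i => f (x i) - f (q i) with hv
  obtain ⟨m, e, he, hvn⟩ := exists_orthonormal_sum_sq_inner_eq v
  obtain ⟨N, hN⟩ : ∃ N : ℝ, N = (Fintype.card (Fin m → ℤˣ) : ℕ) := ⟨_, rfl⟩
  have hNpos : 0 < N := by
    rw [hN]
    exact_mod_cast Fintype.card_pos
  have hweak (φ : (H →L[ℝ] ℝ) →L[ℝ] ℝ) (hφ : ‖φ‖ ≤ 1) :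
      ∑ ε, |φ (signFunctional e ε)| ^ p ≤ N * (4 * A) := by
    simp_rw [map_signFunctional, hN]
    exact sum_abs_signSum_rpow_le hA hexp (he.sum_sq_apply_innerSL_le hφ)
  have hW : 0 ≤ N * (4 * A) := by positivity
  have hsq : ∑ ε, lipNorm (fun x => signFunctional e ε (f x)) ^ p ≤ Cs ^ p * (N * (4 * A)) :=
    sum_lipNorm_rpow_le (u := fun ψ : H →L[ℝ] ℝ => fun x => ψ (f x)) hp hCs hsum
      (signFunctional e) hW hweak
  have hone (t : ℝ) (ht : 0 ≤ t) : t ≤ 1 + t ^ p := by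
    rcases le_total t 1 with h | h
    · linarith [Real.rpow_nonneg ht p]
    · linarith [Real.self_le_rpow_of_one_le h hp]
  have hmean : ∑ ε, lipNorm (fun x => signFunctional e ε (f x))
      ≤ N * (1 + Cs ^ p * (4 * A)) := by
    calc ∑ ε, lipNorm (fun x => signFunctional e ε (f x))
        ≤ ∑ ε, (1 + lipNorm (fun x => signFunctional e ε (f x)) ^ p) :=
          Finset.sum_le_sum fun ε _ => hone _ (lipNorm_nonneg _)
      _ ≤ N + Cs ^ p * (N * (4 * A)) := by
          rw [Finset.sum_add_distrib]
          gcongr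
          simp [hN]
      _ = N * (1 + Cs ^ p * (4 * A)) := by ring
  refine le_of_mul_le_mul_left ?_ hNpos
  calc N * ∑ i, S (x i) (q i) ≤ ∑ i, N * ‖v i‖ := by
        rw [Finset.mul_sum]
        exact Finset.sum_le_sum fun i _ => mul_le_mul_of_nonneg_left (hI _ _) hNpos.le
    _ ≤ ∑ i, 28 * ∑ ε, |signFunctional e ε (v i)| := by
        refine Finset.sum_le_sum fun i _ => ?_
        simp_rw [signFunctional_apply, hN]
        exact card_mul_le_sum_abs_signSum (norm_nonneg _) (hvn i)
    _ = 28 * ∑ ε, ∑ i, |signFunctional e ε (v i)| := by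
        rw [← Finset.mul_sum, Finset.sum_comm]
    _ ≤ 28 * ∑ ε, lipNorm (fun x => signFunctional e ε (f x)) * B := by
        gcongr with ε
        exact hbound _
    _ ≤ 28 * (N * (1 + Cs ^ p * (4 * A)) * B) := by
        rw [← Finset.sum_mul]
        gcongr
    _ = N * (28 * (1 + Cs ^ p * (4 * A)) * B) := by ring
end
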